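/- Let Θ be an E^ℤ-valued process with ‖Θ_0‖ = 1 almost surely which satisfies the time change formula. Then there exists a shift-invariant tail measure ν with index α > 0 on E^ℤ whose spectral tail process has the same law as Θ. Combined with uniqueness, the map which assigns to a shift-invariant tail measure its spectral tail process is a one-to-one correspondence between shift-invariant tail measures of index α and laws of processes Θ with ‖Θ_0‖ = 1 a.s. satisfying the time change formula. -/

import Mathlib

open MeasureTheory
open scoped ENNReal

/-- A measurable cone: a measurable space `E` with a measurable multiplication by positive
scalars, a zero element and a measurable `1`-homogeneous pseudonorm. -/
structure MeasCone (E : Type*) [MeasurableSpace E] where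
  smul : ℝ → E → E
  zero : E
  nrm : E → ℝ
  measurable_smul : Measurable fun p : ℝ × E => smul p.1 p.2
  measurable_nrm : Measurable nrm
  one_smul : ∀ x, smul 1 x = x
  smul_smul : ∀ (u v : ℝ), 0 < u → 0 < v → ∀ x, smul u (smul v x) = smul (u * v) x
  smul_zero' : ∀ (u : ℝ), 0 < u → smul u zero = zero
  nrm_nonneg : ∀ x, 0 ≤ nrm x
  nrm_smul : ∀ (u : ℝ), 0 < u → ∀ x, nrm (smul u x) = u * nrm x
  eq_zero_of_nrm : ∀ x, nrm x = 0 → x = zero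

/-- The `k`-th iterate of the backshift operator: `(B^k x)_h = x_{h-k}`. -/
def seqShift {E : Type*} (k : ℤ) (x : ℤ → E) : ℤ → E := fun h => x (h - k)

/-- Shift invariance of a measure on `E^ℤ`: `ν(BA) = ν(A)` for all measurable `A`. -/
def ShiftInvariant {E : Type*} [MeasurableSpace E] (ν : MeasureTheory.Measure (ℤ → E)) : Prop :=
  ∀ A : Set (ℤ → E), MeasurableSet A → ν (seqShift 1 '' A) = ν A

namespace MeasCone

variable {E : Type*} [MeasurableSpace E] (K : MeasCone E)

/-- The sequence identically equal to the zero element. -/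
def zeroSeq : ℤ → E := fun _ => K.zero

/-- Componentwise scalar multiplication on the sequence space `E^ℤ`. -/
def sSmul (u : ℝ) (x : ℤ → E) : ℤ → E := fun h => K.smul u (x h)


/-- A tail measure with index `α > 0` on `E^ℤ`. -/
def IsTailMeasure (α : ℝ) (ν : Measure (ℤ → E)) : Prop :=
  ν {K.zeroSeq} = 0 ∧
  ν {x | 1 < K.nrm (x 0)} = 1 ∧
  (∀ h : ℤ, ν {x | 1 < K.nrm (x h)} < ⊤) ∧
  ∀ (u : ℝ), 0 < u → ∀ A : Set (ℤ → E), MeasurableSet A →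
    ν (K.sSmul u '' A) = ENNReal.ofReal (u ^ (-α)) * ν A

/-- The spectral map at lag `h`: `x ↦ x / ‖x_h‖`. -/
noncomputable def spectralMap (h : ℤ) (x : ℤ → E) : ℤ → E :=
  fun j => K.smul (K.nrm (x h))⁻¹ (x j)

/-- The law of the local spectral tail process of `ν` at lag `h`:
the pushforward under the spectral map of (the normalization of) the restriction of `ν`
to `{x : ‖x_h‖ > 1}`. -/
noncomputable def spectralLaw (ν : Measure (ℤ → E)) (h : ℤ) : Measure (ℤ → E) :=
  Measure.map (K.spectralMap h)
    ((ν {x | 1 < K.nrm (x h)})⁻¹ • ν.restrict {x | 1 < K.nrm (x h)})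

/-- The time change formula for (the law of) a process `Θ`:
`E[H₀(B^h Θ)] = E[‖Θ_h‖^α H₀(Θ)]` for every measurable `0`-homogeneous
`H₀ : E^ℤ → [0,∞)` vanishing on `{x : ‖x_0‖ = 0}`. -/
def SatisfiesTCF (α : ℝ) (μ : Measure (ℤ → E)) : Prop :=
  ∀ (h : ℤ) (H : (ℤ → E) → ℝ), Measurable H → (∀ x, 0 ≤ H x) →
    (∀ (u : ℝ), 0 < u → ∀ x, H (K.sSmul u x) = H x) →
    (∀ x, K.nrm (x 0) = 0 → H x = 0) →
    ∫⁻ x, ENNReal.ofReal (H (seqShift h x)) ∂μ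
      = ∫⁻ x, ENNReal.ofReal (K.nrm (x h) ^ α) * ENNReal.ofReal (H x) ∂μ

/-- `I(x) = j ∈ ℤ` for the infargmax functional:
`sup_{k ≤ j-1} ‖x_k‖ < ‖x_j‖ = sup_{k ∈ ℤ} ‖x_k‖`. -/
def IsInfArgmax (x : ℤ → E) (j : ℤ) : Prop :=
  (⨆ k : ℤ, ⨆ _ : k < j, ENNReal.ofReal (K.nrm (x k))) < ENNReal.ofReal (K.nrm (x j)) ∧
  ENNReal.ofReal (K.nrm (x j)) = ⨆ k : ℤ, ENNReal.ofReal (K.nrm (x k))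

end MeasCone

/-- The measure `α r^(-α-1) dr` on `(0, ∞)`. -/
noncomputable def radialMeasure (α : ℝ) : Measure ℝ :=
  (volume.restrict (Set.Ioi 0)).withDensity fun r => ENNReal.ofReal (α * r ^ (-α - 1))

instance (α : ℝ) : SFinite (radialMeasure α) := by
  unfold radialMeasure; infer_instance

lemma ae_radialMeasure_pos (α : ℝ) : ∀ᵐ r ∂radialMeasure α, 0 < r :=
  (withDensity_absolutelyContinuous _ _).ae_le (ae_restrict_mem measurableSet_Ioi)

lemma lintegral_radialMeasure (α : ℝ) {f : ℝ → ℝ≥0∞} (hf : Measurable f) :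
    ∫⁻ r, f r ∂radialMeasure α
      = ∫⁻ r in Set.Ioi 0, ENNReal.ofReal (α * r ^ (-α - 1)) * f r := by
  rw [radialMeasure, lintegral_withDensity_eq_lintegral_mul _ (by fun_prop) hf]
  rfl

lemma lintegral_radialMeasure_comp_mul (α : ℝ) {u : ℝ} (hu : 0 < u) {f : ℝ → ℝ≥0∞}
    (hf : Measurable f) :
    ∫⁻ r, f (u * r) ∂radialMeasure α
      = ENNReal.ofReal (u ^ α) * ∫⁻ r, f r ∂radialMeasure α := by
  set g : ℝ → ℝ≥0∞ := (Set.Ioi 0).indicator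
    fun s => ENNReal.ofReal (u ^ (α + 1)) * (ENNReal.ofReal (α * s ^ (-α - 1)) * f s) with hg
  have hgm : Measurable g := by
    refine Measurable.indicator ?_ measurableSet_Ioi
    fun_prop
  rw [lintegral_radialMeasure α (by fun_prop), lintegral_radialMeasure α hf]
  have h1 : ∫⁻ r in Set.Ioi 0, ENNReal.ofReal (α * r ^ (-α - 1)) * f (u * r)
      = ∫⁻ r, g (u * r) := by
    rw [← lintegral_indicator measurableSet_Ioi]
    refine lintegral_congr fun r => ?_
    by_cases hr : 0 < r
    · have hur : 0 < u * r := mul_pos hu hr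
      simp only [hg, Set.indicator, Set.mem_Ioi, hr, hur, if_true]
      rw [← mul_assoc, ← ENNReal.ofReal_mul (by positivity)]
      congr 2
      rw [Real.mul_rpow hu.le hr.le, show -α - 1 = -(α + 1) by ring, Real.rpow_neg hu.le]
      have : u ^ (α + 1) ≠ 0 := by positivity
      field_simp
    · have hur : ¬ 0 < u * r := fun h => hr ((mul_pos_iff_of_pos_left hu).1 h)
      simp [hg, Set.indicator, hr, hur]
  have h2 : ∫⁻ r, g (u * r) = ENNReal.ofReal u⁻¹ * ∫⁻ s, g s := by
    rw [← lintegral_map hgm (by fun_prop), Real.map_volume_mul_left hu.ne', lintegral_smul_measure,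
      abs_of_pos (inv_pos.2 hu), smul_eq_mul]
  rw [h1, h2, hg, lintegral_indicator measurableSet_Ioi, lintegral_const_mul _ (by fun_prop),
    ← mul_assoc, ← ENNReal.ofReal_mul (by positivity), Real.rpow_add hu, Real.rpow_one]
  congr 2
  field_simp

lemma radialMeasure_Ioi_one {α : ℝ} (hα : 0 < α) : radialMeasure α (Set.Ioi 1) = 1 := by
  have hsub : Set.Ioi (1 : ℝ) ⊆ Set.Ioi 0 := Set.Ioi_subset_Ioi zero_le_one
  rw [radialMeasure, withDensity_apply _ measurableSet_Ioi,
    Measure.restrict_restrict measurableSet_Ioi, Set.inter_eq_left.2 hsub,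
    ← ofReal_integral_eq_lintegral_ofReal, integral_const_mul,
    integral_Ioi_rpow_of_lt (by linarith) one_pos]
  · have : α * (-1 ^ (-α - 1 + 1) / (-α - 1 + 1)) = 1 := by
      rw [Real.one_rpow]
      have : -α - 1 + 1 ≠ 0 := by linarith
      field_simp
      ring
    rw [this, ENNReal.ofReal_one]
  · exact (integrableOn_Ioi_rpow_of_lt (by linarith) one_pos).const_mul α
  · filter_upwards [ae_restrict_mem measurableSet_Ioi] with r hr
    have : (0 : ℝ) < r := hsub hr
    positivity

lemma lintegral_radialMeasure_rpow_lt {α : ℝ} (hα : 0 < α) {t : ℝ} (ht : 0 < t) :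
    ∫⁻ r, (if r < t then ENNReal.ofReal (r ^ α * r ^ α) else 0) ∂radialMeasure α
      = ENNReal.ofReal (t ^ α) := by
  rw [lintegral_radialMeasure α
    (Measurable.ite measurableSet_Iio (by fun_prop) measurable_const)]
  have h1 : ∫⁻ r in Set.Ioi 0, ENNReal.ofReal (α * r ^ (-α - 1)) *
        (if r < t then ENNReal.ofReal (r ^ α * r ^ α) else 0)
      = ∫⁻ r in Set.Ioo 0 t, ENNReal.ofReal (α * r ^ (α - 1)) := by
    rw [← lintegral_indicator measurableSet_Ioi, ← lintegral_indicator measurableSet_Ioo]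
    refine lintegral_congr fun r => ?_
    by_cases hr : 0 < r
    · by_cases hrt : r < t
      · simp only [Set.indicator, Set.mem_Ioi, Set.mem_Ioo, hr, hrt, if_true, and_self]
        rw [← ENNReal.ofReal_mul (by positivity), mul_assoc, ← Real.rpow_add hr,
          ← Real.rpow_add hr]
        ring_nf
      · simp [Set.indicator, hrt]
    · simp [Set.indicator, hr]
  rw [h1, Measure.restrict_congr_set Ioo_ae_eq_Ioc]
  have hint : IntervalIntegrable (fun r : ℝ => α * r ^ (α - 1)) volume 0 t :=
    (intervalIntegral.intervalIntegrable_rpow' (by linarith)).const_mul α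
  rw [← ofReal_integral_eq_lintegral_ofReal
      ((intervalIntegrable_iff_integrableOn_Ioc_of_le ht.le).1 hint),
    ← intervalIntegral.integral_of_le ht.le, intervalIntegral.integral_const_mul,
    integral_rpow (Or.inl (by linarith))]
  · congr 1
    rw [sub_add_cancel, Real.zero_rpow hα.ne']
    field_simp
    ring
  · filter_upwards [ae_restrict_mem measurableSet_Ioc] with r hr
    have : (0 : ℝ) < r := hr.1
    positivity

/-- Measures that agree on pairwise overlaps of a countable family of sets glue together. -/
lemma exists_measure_restrict_eq {X ι : Type*} [MeasurableSpace X] [Countable ι] [Nonempty ι]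
    (S : ι → Set X) (hS : ∀ i, MeasurableSet (S i)) (m : ι → Measure X)
    (hm : ∀ i, (m i).restrict (S i) = m i)
    (hcompat : ∀ i j, (m i).restrict (S j) = (m j).restrict (S i)) :
    ∃ ν : Measure X, ν (⋃ i, S i)ᶜ = 0 ∧ ∀ i, ν.restrict (S i) = m i := by
  obtain ⟨e, he⟩ := exists_surjective_nat ι
  set D : ℕ → Set X := disjointed fun n => S (e n) with hD
  have hDm : ∀ n, MeasurableSet (D n) := fun n => .disjointed (fun n => hS (e n)) n
  have hDsub : ∀ n, D n ⊆ S (e n) := fun n => disjointed_subset _ n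
  have hDU : ⋃ n, D n = ⋃ i, S i := by
    rw [hD, iUnion_disjointed, he.iUnion_comp]
  refine ⟨Measure.sum fun n => (m (e n)).restrict (D n), ?_, fun i => ?_⟩
  · rw [Measure.sum_apply _ (MeasurableSet.iUnion hS).compl, ENNReal.tsum_eq_zero]
    intro n
    rw [Measure.restrict_apply (MeasurableSet.iUnion hS).compl, ← hDU]
    convert measure_empty (μ := m (e n))
    ext x
    simp only [Set.mem_inter_iff, Set.mem_compl_iff, Set.mem_iUnion, Set.mem_empty_iff_false]
    exact iff_false_intro fun h => h.1 ⟨n, h.2⟩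
  · have key : ∀ n, ((m (e n)).restrict (D n)).restrict (S i) = (m i).restrict (D n) := by
      intro n
      rw [Measure.restrict_restrict (hS i), Set.inter_comm, ← Measure.restrict_restrict (hDm n),
        hcompat, Measure.restrict_restrict (hDm n), Set.inter_eq_left.2 (hDsub n)]
    rw [Measure.restrict_sum _ (hS i)]
    simp_rw [key]
    rw [← Measure.restrict_iUnion (disjoint_disjointed _) hDm, hDU, ← hm i,
      Measure.restrict_restrict (MeasurableSet.iUnion hS),
      Set.inter_eq_right.2 (Set.subset_iUnion S i)]

lemma seqShift_seqShift {E : Type*} (a b : ℤ) (x : ℤ → E) :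
    seqShift a (seqShift b x) = seqShift (a + b) x := by
  funext h
  simp only [seqShift]
  congr 1
  ring

lemma seqShift_zero {E : Type*} (x : ℤ → E) : seqShift 0 x = x := by
  funext h
  simp [seqShift]

@[fun_prop]
lemma measurable_seqShift {E : Type*} [MeasurableSpace E] (k : ℤ) :
    Measurable (seqShift k : (ℤ → E) → ℤ → E) :=
  measurable_pi_lambda _ fun h => measurable_pi_apply (h - k)

lemma image_seqShift {E : Type*} (k : ℤ) (A : Set (ℤ → E)) :
    seqShift k '' A = seqShift (-k) ⁻¹' A :=
  congrFun (Set.image_eq_preimage_of_inverse (f := seqShift k) (g := seqShift (-k))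
    (fun x => by rw [seqShift_seqShift, neg_add_cancel, seqShift_zero])
    (fun x => by rw [seqShift_seqShift, add_neg_cancel, seqShift_zero])) A

lemma shiftInvariant_iff_map {E : Type*} [MeasurableSpace E] {ν : Measure (ℤ → E)} :
    ShiftInvariant ν ↔ ν.map (seqShift (-1)) = ν := by
  refine ⟨fun h => Measure.ext fun A hA => ?_, fun h A hA => ?_⟩
  · rw [Measure.map_apply (by fun_prop) hA, ← image_seqShift, h A hA]
  · rw [image_seqShift, ← Measure.map_apply (by fun_prop) hA, h]

lemma ShiftInvariant.map_seqShift {E : Type*} [MeasurableSpace E] {ν : Measure (ℤ → E)}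
    (h : ShiftInvariant ν) (k : ℤ) : ν.map (seqShift k) = ν := by
  have hcomp : ∀ a b : ℤ, (ν.map (seqShift b)).map (seqShift a) = ν.map (seqShift (a + b)) := by
    intro a b
    rw [Measure.map_map (by fun_prop) (by fun_prop)]
    congr 1
    exact funext fun x => seqShift_seqShift a b x
  have h0 : ν.map (seqShift 0) = ν := by
    rw [show (seqShift 0 : (ℤ → E) → ℤ → E) = id from funext seqShift_zero, Measure.map_id]
  have hneg := shiftInvariant_iff_map.1 h
  have hpos : ν.map (seqShift 1) = ν := by
    conv_lhs => rw [← hneg]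
    rw [hcomp, add_neg_cancel, h0]
  induction k using Int.induction_on with
  | zero => exact h0
  | succ k ih => rw [← hcomp, hpos, ih]
  | pred k ih => rw [sub_eq_add_neg, ← hcomp, hneg, ih]

namespace MeasCone

variable {E : Type*} [MeasurableSpace E] (K : MeasCone E)

lemma nrm_zero : K.nrm K.zero = 0 := by
  have h := K.nrm_smul 2 two_pos K.zero
  rw [K.smul_zero' 2 two_pos] at h
  linarith

@[fun_prop]
lemma measurable_nrm_apply (h : ℤ) : Measurable fun x : ℤ → E => K.nrm (x h) :=
  K.measurable_nrm.comp (measurable_pi_apply h)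

lemma measurable_sSmul_prod : Measurable fun p : ℝ × (ℤ → E) => K.sSmul p.1 p.2 :=
  measurable_pi_lambda _ fun h => K.measurable_smul.comp
    (measurable_fst.prodMk ((measurable_pi_apply h).comp measurable_snd))

@[fun_prop]
lemma measurable_sSmul_comp {X : Type*} [MeasurableSpace X] {f : X → ℝ} {g : X → ℤ → E}
    (hf : Measurable f) (hg : Measurable g) : Measurable fun x => K.sSmul (f x) (g x) :=
  K.measurable_sSmul_prod.comp (hf.prodMk hg)

lemma sSmul_sSmul {u v : ℝ} (hu : 0 < u) (hv : 0 < v) (x : ℤ → E) :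
    K.sSmul u (K.sSmul v x) = K.sSmul (u * v) x :=
  funext fun h => K.smul_smul u v hu hv (x h)

lemma one_sSmul (x : ℤ → E) : K.sSmul 1 x = x := funext fun h => K.one_smul (x h)

lemma nrm_sSmul {u : ℝ} (hu : 0 < u) (x : ℤ → E) (h : ℤ) :
    K.nrm (K.sSmul u x h) = u * K.nrm (x h) := K.nrm_smul u hu (x h)

lemma image_sSmul {u : ℝ} (hu : 0 < u) (A : Set (ℤ → E)) :
    K.sSmul u '' A = K.sSmul u⁻¹ ⁻¹' A :=
  congrFun (Set.image_eq_preimage_of_inverse (f := K.sSmul u) (g := K.sSmul u⁻¹)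
    (fun x => by rw [K.sSmul_sSmul (inv_pos.2 hu) hu, inv_mul_cancel₀ hu.ne', K.one_sSmul])
    (fun x => by rw [K.sSmul_sSmul hu (inv_pos.2 hu), mul_inv_cancel₀ hu.ne', K.one_sSmul])) A

/-- The sequences that do not vanish at lag `j`. -/
def nonvanishing (j : ℤ) : Set (ℤ → E) := {x | 0 < K.nrm (x j)}

@[measurability]
lemma measurableSet_nonvanishing (j : ℤ) : MeasurableSet (K.nonvanishing j) :=
  measurableSet_lt measurable_const (K.measurable_nrm_apply j)

lemma iUnion_nonvanishing : ⋃ j, K.nonvanishing j = {K.zeroSeq}ᶜ := by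
  ext x
  simp only [Set.mem_iUnion, nonvanishing, Set.mem_ofPred_eq, Set.mem_compl_iff,
    Set.mem_singleton_iff]
  constructor
  · rintro ⟨j, hj⟩ rfl
    rw [zeroSeq, K.nrm_zero] at hj
    exact lt_irrefl _ hj
  · intro hx
    by_contra! hcon
    exact hx (funext fun j => K.eq_zero_of_nrm _ (le_antisymm (hcon j) (K.nrm_nonneg _)))

lemma measurableSet_zeroSeq : MeasurableSet {K.zeroSeq} := by
  rw [← MeasurableSet.compl_iff, ← K.iUnion_nonvanishing]
  exact MeasurableSet.iUnion K.measurableSet_nonvanishing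

lemma sSmul_zeroSeq {u : ℝ} (hu : 0 < u) : K.sSmul u K.zeroSeq = K.zeroSeq :=
  funext fun _ => K.smul_zero' u hu

lemma preimage_sSmul_nonvanishing {u : ℝ} (hu : 0 < u) (j : ℤ) :
    K.sSmul u ⁻¹' K.nonvanishing j = K.nonvanishing j := by
  ext x
  simp [nonvanishing, K.nrm_sSmul hu, hu]

lemma preimage_seqShift_nonvanishing (k j : ℤ) :
    seqShift k ⁻¹' K.nonvanishing j = K.nonvanishing (j - k) := rfl

lemma ext_of_restrict_nonvanishing {ν ν' : Measure (ℤ → E)} (h0 : ν {K.zeroSeq} = 0)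
    (h0' : ν' {K.zeroSeq} = 0)
    (h : ∀ j, ν.restrict (K.nonvanishing j) = ν'.restrict (K.nonvanishing j)) : ν = ν' := by
  have hU := Measure.restrict_iUnion_congr.2 h
  rw [K.iUnion_nonvanishing] at hU
  have hae : ∀ {ρ : Measure (ℤ → E)}, ρ {K.zeroSeq} = 0 → ρ.restrict {K.zeroSeq}ᶜ = ρ :=
    fun hρ => Measure.restrict_eq_self_of_ae_mem (compl_mem_ae_iff.2 hρ)
  rwa [hae h0, hae h0'] at hU

lemma IsTailMeasure.map_sSmul {K : MeasCone E} {α : ℝ} {ν : Measure (ℤ → E)}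
    (h : K.IsTailMeasure α ν) {u : ℝ} (hu : 0 < u) :
    ν.map (K.sSmul u) = ENNReal.ofReal (u ^ α) • ν := by
  refine Measure.ext fun A hA => ?_
  have := h.2.2.2 u⁻¹ (inv_pos.2 hu) A hA
  rw [K.image_sSmul (inv_pos.2 hu), inv_inv, Real.inv_rpow hu.le, Real.rpow_neg hu.le,
    inv_inv] at this
  rw [Measure.map_apply (by fun_prop) hA, this, Measure.smul_apply, smul_eq_mul]

lemma IsTailMeasure.sFinite_restrict {K : MeasCone E} {α : ℝ} {ν : Measure (ℤ → E)}
    (h : K.IsTailMeasure α ν) : SFinite (ν.restrict (K.nonvanishing 0)) := by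
  set V : ℕ → Set (ℤ → E) := fun n => K.sSmul ((n : ℝ) + 1)⁻¹ '' {x | 1 < K.nrm (x 0)} with hV
  have hUm : MeasurableSet {x : ℤ → E | 1 < K.nrm (x 0)} :=
    measurableSet_lt measurable_const (K.measurable_nrm_apply 0)
  have hpos : ∀ n : ℕ, 0 < ((n : ℝ) + 1)⁻¹ := fun n => by positivity
  have hfin : ∀ n, ν (V n) < ⊤ := fun n => by
    rw [hV, h.2.2.2 _ (hpos n) _ hUm, h.2.1, mul_one]
    exact ENNReal.ofReal_lt_top
  have hsub : K.nonvanishing 0 ⊆ ⋃ n, V n := fun x hx => by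
    have hx0 : 0 < K.nrm (x 0) := hx
    obtain ⟨n, hn⟩ := exists_nat_gt (K.nrm (x 0))⁻¹
    refine Set.mem_iUnion.2 ⟨n, ?_⟩
    simp only [hV]
    rw [K.image_sSmul (hpos n), inv_inv]
    change 1 < K.nrm (K.sSmul _ x 0)
    rw [K.nrm_sSmul (by positivity)]
    rw [inv_lt_iff_one_lt_mul₀ hx0] at hn
    nlinarith
  have hVm : ∀ n, MeasurableSet (V n) := fun n => by
    simp only [hV]
    rw [K.image_sSmul (hpos n)]
    exact (K.measurable_sSmul_comp measurable_const measurable_id) hUm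
  have : ∀ n, IsFiniteMeasure (ν.restrict (disjointed V n)) := fun n => ⟨by
    rw [Measure.restrict_apply_univ]
    exact (measure_mono (disjointed_subset V n)).trans_lt (hfin n)⟩
  have hsf : SFinite (ν.restrict (⋃ n, V n)) := by
    rw [← iUnion_disjointed,
      Measure.restrict_iUnion (disjoint_disjointed V) (.disjointed hVm)]
    infer_instance
  rw [← Set.inter_eq_left.2 hsub, ← Measure.restrict_restrict (K.measurableSet_nonvanishing 0)]
  infer_instance

lemma SatisfiesTCF.lintegral_eq {K : MeasCone E} {α : ℝ} {μ : Measure (ℤ → E)}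
    (hTCF : K.SatisfiesTCF α μ) (h : ℤ) {H : (ℤ → E) → ℝ≥0∞} (hH : Measurable H)
    (hhom : ∀ (u : ℝ), 0 < u → ∀ x, H (K.sSmul u x) = H x)
    (hvan : ∀ x, K.nrm (x 0) = 0 → H x = 0) :
    ∫⁻ x, H (seqShift h x) ∂μ = ∫⁻ x, ENNReal.ofReal (K.nrm (x h) ^ α) * H x ∂μ := by
  have hsup : ∀ a : ℝ≥0∞, a = ⨆ n : ℕ, min a n := by
    intro a
    rw [← inf_iSup_eq, ENNReal.iSup_natCast, inf_top_eq]
  have hmono : ∀ a : ℝ≥0∞, Monotone fun n : ℕ => min a (n : ℝ≥0∞) := fun a m n hmn =>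
    min_le_min_left a (by exact_mod_cast hmn)
  have hfin : ∀ (n : ℕ) x, min (H x) (n : ℝ≥0∞) ≠ ⊤ := fun n x =>
    ((min_le_right _ _).trans_lt (ENNReal.natCast_lt_top n)).ne
  have key : ∀ n : ℕ, ∫⁻ x, min (H (seqShift h x)) n ∂μ
      = ∫⁻ x, ENNReal.ofReal (K.nrm (x h) ^ α) * min (H x) n ∂μ := by
    intro n
    have := hTCF h (fun x => (min (H x) n).toReal) (by fun_prop) (fun x => ENNReal.toReal_nonneg)
      (fun u hu x => by simp only [hhom u hu x]) (fun x hx => by simp [hvan x hx])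
    simpa only [ENNReal.ofReal_toReal (hfin n _)] using this
  calc ∫⁻ x, H (seqShift h x) ∂μ
      = ∫⁻ x, ⨆ n : ℕ, min (H (seqShift h x)) n ∂μ := lintegral_congr fun x => hsup _
    _ = ⨆ n : ℕ, ∫⁻ x, min (H (seqShift h x)) n ∂μ :=
        lintegral_iSup (fun n => by fun_prop) fun m n hmn x => hmono _ hmn
    _ = ⨆ n : ℕ, ∫⁻ x, ENNReal.ofReal (K.nrm (x h) ^ α) * min (H x) n ∂μ := by simp_rw [key]
    _ = ∫⁻ x, ⨆ n : ℕ, ENNReal.ofReal (K.nrm (x h) ^ α) * min (H x) n ∂μ :=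
        (lintegral_iSup (f := fun (n : ℕ) x => ENNReal.ofReal (K.nrm (x h) ^ α) * min (H x) n)
          (fun n => by fun_prop) fun m n hmn x => by
            dsimp only
            gcongr).symm
    _ = ∫⁻ x, ENNReal.ofReal (K.nrm (x h) ^ α) * H x ∂μ := by
        refine lintegral_congr fun x => ?_
        rw [← ENNReal.mul_iSup, ← hsup]

/-- The law of `r • B^j Θ`, where `Θ` has law `μ` and `r` is independent with
distribution `radialMeasure α`. -/
noncomputable def polarMeasure (α : ℝ) (μ : Measure (ℤ → E)) (j : ℤ) : Measure (ℤ → E) :=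
  ((radialMeasure α).prod μ).map fun p => K.sSmul p.1 (seqShift j p.2)

lemma lintegral_polarMeasure (α : ℝ) (μ : Measure (ℤ → E)) [SFinite μ] (j : ℤ)
    {f : (ℤ → E) → ℝ≥0∞} (hf : Measurable f) :
    ∫⁻ x, f x ∂K.polarMeasure α μ j
      = ∫⁻ x, ∫⁻ r, f (K.sSmul r (seqShift j x)) ∂radialMeasure α ∂μ := by
  rw [polarMeasure, lintegral_map hf (by fun_prop), lintegral_prod_symm' _ (by fun_prop)]

lemma lintegral_radialMeasure_sSmul (α : ℝ) {u : ℝ} (hu : 0 < u) {f : (ℤ → E) → ℝ≥0∞}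
    (hf : Measurable f) (x : ℤ → E) :
    ∫⁻ r, f (K.sSmul r (K.sSmul u x)) ∂radialMeasure α
      = ENNReal.ofReal (u ^ α) * ∫⁻ r, f (K.sSmul r x) ∂radialMeasure α := by
  rw [← lintegral_radialMeasure_comp_mul α hu (f := fun r => f (K.sSmul r x)) (by fun_prop)]
  refine lintegral_congr_ae ?_
  filter_upwards [ae_radialMeasure_pos α] with r hr
  rw [K.sSmul_sSmul hr hu, mul_comm]

lemma map_seqShift_polarMeasure (α : ℝ) (μ : Measure (ℤ → E)) (k j : ℤ) :
    (K.polarMeasure α μ j).map (seqShift k) = K.polarMeasure α μ (k + j) := by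
  rw [polarMeasure, Measure.map_map (by fun_prop) (by fun_prop), polarMeasure]
  congr 1
  funext p
  rw [← seqShift_seqShift]
  rfl

lemma map_sSmul_polarMeasure (α : ℝ) (μ : Measure (ℤ → E)) [SFinite μ] (j : ℤ) {u : ℝ}
    (hu : 0 < u) :
    (K.polarMeasure α μ j).map (K.sSmul u) = ENNReal.ofReal (u ^ α) • K.polarMeasure α μ j := by
  refine Measure.ext_of_lintegral _ fun f hf => ?_
  rw [lintegral_map hf (by fun_prop), lintegral_smul_measure, K.lintegral_polarMeasure α μ j hf,
    K.lintegral_polarMeasure α μ j (by fun_prop), smul_eq_mul,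
    ← lintegral_const_mul' _ _ ENNReal.ofReal_ne_top]
  refine lintegral_congr fun x => ?_
  rw [← K.lintegral_radialMeasure_sSmul α hu hf]
  refine lintegral_congr_ae ?_
  filter_upwards [ae_radialMeasure_pos α] with r hr
  rw [K.sSmul_sSmul hu hr, K.sSmul_sSmul hr hu, mul_comm]

lemma restrict_polarMeasure_nonvanishing {α : ℝ} {μ : Measure (ℤ → E)} [SFinite μ]
    (hμ : ∀ᵐ x ∂μ, K.nrm (x 0) = 1) (j : ℤ) :
    (K.polarMeasure α μ j).restrict (K.nonvanishing j) = K.polarMeasure α μ j := by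
  refine Measure.restrict_eq_self_of_ae_mem ?_
  refine (ae_map_iff (by fun_prop) (K.measurableSet_nonvanishing j)).2 ?_
  filter_upwards [Measure.quasiMeasurePreserving_fst.ae (ae_radialMeasure_pos α),
    Measure.quasiMeasurePreserving_snd.ae hμ] with p hp hp'
  rwa [K.nrm_sSmul hp, seqShift, sub_self, hp', mul_one]

lemma polarMeasure_restrict_nonvanishing_zero {α : ℝ} {μ : Measure (ℤ → E)} [SFinite μ]
    (hμ : ∀ᵐ x ∂μ, K.nrm (x 0) = 1) (hTCF : K.SatisfiesTCF α μ) (h : ℤ) :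
    (K.polarMeasure α μ h).restrict (K.nonvanishing 0)
      = (K.polarMeasure α μ 0).restrict (K.nonvanishing h) := by
  have hS := K.measurableSet_nonvanishing
  rw [← K.restrict_polarMeasure_nonvanishing hμ h, ← K.restrict_polarMeasure_nonvanishing hμ 0,
    Measure.restrict_restrict (hS 0), Measure.restrict_restrict (hS h),
    Set.inter_comm (K.nonvanishing h)]
  refine Measure.ext fun A hA => ?_
  rw [Measure.restrict_apply hA, Measure.restrict_apply hA]
  set C := A ∩ (K.nonvanishing 0 ∩ K.nonvanishing h) with hC
  have hCm : MeasurableSet C := hA.inter ((hS 0).inter (hS h))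
  have hfm : Measurable (C.indicator (1 : (ℤ → E) → ℝ≥0∞)) := measurable_one.indicator hCm
  rw [← lintegral_indicator_one hCm, ← lintegral_indicator_one hCm,
    K.lintegral_polarMeasure _ _ _ hfm, K.lintegral_polarMeasure _ _ _ hfm]
  set G : (ℤ → E) → ℝ≥0∞ :=
    fun x => ∫⁻ r, C.indicator 1 (K.sSmul r x) ∂radialMeasure α with hG
  have hGm : Measurable G :=
    Measurable.lintegral_prod_right' (f := fun p : (ℤ → E) × ℝ => C.indicator 1 (K.sSmul p.2 p.1))
      (by fun_prop)
  have hGhom : ∀ u : ℝ, 0 < u → ∀ x, G (K.sSmul u x) = ENNReal.ofReal (u ^ α) * G x := by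
    intro u hu x
    exact K.lintegral_radialMeasure_sSmul α hu hfm x
  have hGvan : ∀ x j, C ⊆ K.nonvanishing j → K.nrm (x j) = 0 → G x = 0 := by
    intro x j hj hx
    rw [hG, ← lintegral_zero (μ := radialMeasure α)]
    refine lintegral_congr_ae ?_
    filter_upwards [ae_radialMeasure_pos α] with r hr
    refine Set.indicator_of_notMem (fun hmem => ?_) _
    have : 0 < K.nrm (K.sSmul r x j) := hj hmem
    rw [K.nrm_sSmul hr, hx, mul_zero] at this
    exact lt_irrefl _ this
  have hTCF' := hTCF.lintegral_eq h (H := fun x => ENNReal.ofReal (K.nrm (x h) ^ (-α)) * G x)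
    (by fun_prop)
    (fun u hu x => by
      simp only [hGhom u hu, K.nrm_sSmul hu]
      rw [← mul_assoc, ← ENNReal.ofReal_mul (Real.rpow_nonneg (mul_nonneg hu.le (K.nrm_nonneg _)) _),
        Real.mul_rpow hu.le (K.nrm_nonneg _), Real.rpow_neg hu.le]
      have : u ^ α ≠ 0 := by positivity
      field_simp)
    (fun x hx => by
      rw [hGvan x 0 (fun y hy => hy.2.1) hx, mul_zero])
  calc ∫⁻ x, G (seqShift h x) ∂μ
      = ∫⁻ x, ENNReal.ofReal (K.nrm (seqShift h x h) ^ (-α)) * G (seqShift h x) ∂μ := by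
        refine lintegral_congr_ae ?_
        filter_upwards [hμ] with x hx
        simp [seqShift, hx]
    _ = ∫⁻ x, ENNReal.ofReal (K.nrm (x h) ^ α) *
          (ENNReal.ofReal (K.nrm (x h) ^ (-α)) * G x) ∂μ := hTCF'
    _ = ∫⁻ x, G (seqShift 0 x) ∂μ := by
        refine lintegral_congr fun x => ?_
        rw [seqShift_zero]
        rcases (K.nrm_nonneg (x h)).eq_or_lt with hx | hx
        · rw [hGvan x h (fun y hy => hy.2.2) hx.symm, mul_zero, mul_zero]
        · rw [← mul_assoc, ← ENNReal.ofReal_mul (by positivity), ← Real.rpow_add hx,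
            add_neg_cancel, Real.rpow_zero, ENNReal.ofReal_one, one_mul]

lemma polarMeasure_restrict_comm {α : ℝ} {μ : Measure (ℤ → E)} [SFinite μ]
    (hμ : ∀ᵐ x ∂μ, K.nrm (x 0) = 1) (hTCF : K.SatisfiesTCF α μ) (i j : ℤ) :
    (K.polarMeasure α μ i).restrict (K.nonvanishing j)
      = (K.polarMeasure α μ j).restrict (K.nonvanishing i) := by
  have h := congrArg (Measure.map (seqShift j))
    (K.polarMeasure_restrict_nonvanishing_zero hμ hTCF (i - j))
  have hpre : ∀ k, K.nonvanishing k = seqShift j ⁻¹' K.nonvanishing (k + j) := fun k => by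
    rw [K.preimage_seqShift_nonvanishing, add_sub_cancel_right]
  rwa [hpre 0, hpre (i - j), ← Measure.restrict_map (by fun_prop) (K.measurableSet_nonvanishing _),
    ← Measure.restrict_map (by fun_prop) (K.measurableSet_nonvanishing _),
    map_seqShift_polarMeasure, map_seqShift_polarMeasure, zero_add, add_zero, sub_add_cancel,
    add_sub_cancel] at h

lemma measurableSet_one_lt_nrm (h : ℤ) : MeasurableSet {x : ℤ → E | 1 < K.nrm (x h)} :=
  measurableSet_lt measurable_const (K.measurable_nrm_apply h)

lemma one_lt_nrm_subset (h : ℤ) : {x : ℤ → E | 1 < K.nrm (x h)} ⊆ K.nonvanishing h :=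
  fun x (hx : 1 < K.nrm (x h)) => (zero_lt_one.trans hx : 0 < K.nrm (x h))

lemma measurable_spectralMap (h : ℤ) : Measurable (K.spectralMap h) :=
  K.measurable_sSmul_comp (K.measurable_nrm_apply h).inv measurable_id

/-- In polar coordinates the radial and the spectral parts are independent. -/
lemma polarMeasure_one_lt_inter_spectralMap {α : ℝ} (hα : 0 < α) {μ : Measure (ℤ → E)} [SFinite μ]
    (hμ : ∀ᵐ x ∂μ, K.nrm (x 0) = 1) (j : ℤ) {A : Set (ℤ → E)} (hA : MeasurableSet A) :
    K.polarMeasure α μ j (K.spectralMap j ⁻¹' A ∩ {x | 1 < K.nrm (x j)})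
      = μ (seqShift j ⁻¹' A) := by
  rw [polarMeasure, Measure.map_apply (by fun_prop)
    ((K.measurable_spectralMap j hA).inter (K.measurableSet_one_lt_nrm j)),
    ← one_mul (μ _), ← radialMeasure_Ioi_one hα, ← Measure.prod_prod]
  refine measure_congr ?_
  filter_upwards [Measure.quasiMeasurePreserving_fst.ae (ae_radialMeasure_pos α),
    Measure.quasiMeasurePreserving_snd.ae hμ] with p hp hp'
  have h1 : K.nrm (K.sSmul p.1 (seqShift j p.2) j) = p.1 := by
    rw [K.nrm_sSmul hp, seqShift, sub_self, hp', mul_one]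
  have h2 : K.spectralMap j (K.sSmul p.1 (seqShift j p.2)) = seqShift j p.2 := by
    change K.sSmul (K.nrm (K.sSmul p.1 (seqShift j p.2) j))⁻¹ _ = _
    rw [h1, K.sSmul_sSmul (inv_pos.2 hp) hp, inv_mul_cancel₀ hp.ne', K.one_sSmul]
  refine propext ?_
  change (K.spectralMap j (K.sSmul p.1 (seqShift j p.2)) ∈ A ∧
    1 < K.nrm (K.sSmul p.1 (seqShift j p.2) j)) ↔ (1 < p.1 ∧ seqShift j p.2 ∈ A)
  rw [h1, h2, and_comm]

/-- On sequences that do not vanish at lag `0`, a tail measure is determined by its spectral law. -/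
lemma IsTailMeasure.restrict_nonvanishing_zero {K : MeasCone E} {α : ℝ} (hα : 0 < α)
    {ν : Measure (ℤ → E)} (h : K.IsTailMeasure α ν) :
    ν.restrict (K.nonvanishing 0) = K.polarMeasure α (K.spectralLaw ν 0) 0 := by
  have hS := K.measurableSet_nonvanishing 0
  set U : Set (ℤ → E) := {x | 1 < K.nrm (x 0)} with hU
  have hUm : MeasurableSet U := K.measurableSet_one_lt_nrm 0
  have hlaw : K.spectralLaw ν 0 = (ν.restrict U).map (K.spectralMap 0) := by
    rw [spectralLaw, h.2.1, inv_one, MulAction.one_smul]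
  have hUfin : IsFiniteMeasure (ν.restrict U) := ⟨by
    rw [Measure.restrict_apply_univ]; exact h.2.2.1 0⟩
  have hsf := h.sFinite_restrict
  rw [hlaw]
  refine Measure.ext_of_lintegral _ fun f hf => ?_
  set F : ℝ → (ℤ → E) → ℝ≥0∞ := fun r y =>
    (if r < K.nrm (y 0) then ENNReal.ofReal (r ^ α * K.nrm (y 0) ^ (-α)) else 0) * f y with hF
  have hFm : Measurable fun p : ℝ × (ℤ → E) => F p.1 p.2 := by
    have hn : Measurable fun p : ℝ × (ℤ → E) => K.nrm (p.2 0) :=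
      (K.measurable_nrm_apply 0).comp measurable_snd
    exact Measurable.mul (Measurable.ite (measurableSet_lt measurable_fst hn) (by fun_prop)
      measurable_const) (by fun_prop)
  have hFm' : ∀ r, Measurable (F r) := fun r => hFm.comp measurable_prodMk_left
  symm
  calc ∫⁻ x, f x ∂K.polarMeasure α ((ν.restrict U).map (K.spectralMap 0)) 0
      = ∫⁻ x in U, ∫⁻ r, f (K.sSmul r (K.spectralMap 0 x)) ∂radialMeasure α ∂ν := by
        rw [K.lintegral_polarMeasure _ _ _ hf]
        simp_rw [seqShift_zero]
        exact lintegral_map (Measurable.lintegral_prod_right'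
          (f := fun p : (ℤ → E) × ℝ => f (K.sSmul p.2 p.1)) (by fun_prop))
          (K.measurable_spectralMap 0)
    _ = ∫⁻ x in U, ∫⁻ r, ENNReal.ofReal (K.nrm (x 0) ^ (-α)) * f (K.sSmul r x)
          ∂radialMeasure α ∂ν := by
        refine setLIntegral_congr_fun hUm fun x hx => ?_
        have hx0 : 0 < K.nrm (x 0) := K.one_lt_nrm_subset 0 hx
        have := K.lintegral_radialMeasure_sSmul α (inv_pos.2 hx0) hf x
        rw [Real.inv_rpow hx0.le, ← Real.rpow_neg hx0.le] at this
        rw [lintegral_const_mul _ (by fun_prop), ← this]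
        rfl
    _ = ∫⁻ r, ∫⁻ x in U, ENNReal.ofReal (K.nrm (x 0) ^ (-α)) * f (K.sSmul r x) ∂ν
          ∂radialMeasure α :=
        lintegral_lintegral_swap (Measurable.aemeasurable (by
          have hn : Measurable fun p : (ℤ → E) × ℝ => K.nrm (p.1 0) :=
            (K.measurable_nrm_apply 0).comp measurable_fst
          exact Measurable.mul (by fun_prop) (by fun_prop)))
    _ = ∫⁻ r, ∫⁻ x in K.nonvanishing 0, ENNReal.ofReal (r ^ α) * F r x ∂ν ∂radialMeasure α := by
        refine lintegral_congr_ae ?_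
        filter_upwards [ae_radialMeasure_pos α] with r hr
        have hrα : r ^ α ≠ 0 := by positivity
        rw [← lintegral_indicator hUm, lintegral_const_mul _ (hFm' r), ← smul_eq_mul,
          ← lintegral_smul_measure, ← Measure.restrict_smul, ← h.map_sSmul hr,
          setLIntegral_map hS (hFm' r) (by fun_prop), K.preimage_sSmul_nonvanishing hr,
          ← lintegral_indicator hS]
        refine lintegral_congr fun x => ?_
        by_cases hxU : 1 < K.nrm (x 0)
        · have hx0 : 0 < K.nrm (x 0) := K.one_lt_nrm_subset 0 hxU
          have hlt : r < r * K.nrm (x 0) := by nlinarith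
          rw [Set.indicator_of_mem (show x ∈ U from hxU),
            Set.indicator_of_mem (show x ∈ K.nonvanishing 0 from hx0)]
          simp only [hF, K.nrm_sSmul hr, hlt, if_true]
          rw [Real.mul_rpow hr.le hx0.le, Real.rpow_neg hr.le, mul_inv_cancel_left₀ hrα]
        · have hlt : ¬ r < r * K.nrm (x 0) := by nlinarith
          rw [Set.indicator_of_notMem (show x ∉ U from hxU)]
          simp [hF, K.nrm_sSmul hr, hlt, Set.indicator]
    _ = ∫⁻ x in K.nonvanishing 0, ∫⁻ r, ENNReal.ofReal (r ^ α) * F r x ∂radialMeasure α ∂ν :=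
        lintegral_lintegral_swap
          (((by fun_prop : Measurable fun p : ℝ × (ℤ → E) => ENNReal.ofReal (p.1 ^ α)).mul
            hFm).aemeasurable)
    _ = ∫⁻ x in K.nonvanishing 0, f x ∂ν := by
        refine setLIntegral_congr_fun hS fun x hx => ?_
        have hx0 : 0 < K.nrm (x 0) := hx
        have hrew : ∀ᵐ r ∂radialMeasure α, ENNReal.ofReal (r ^ α) * F r x
            = (if r < K.nrm (x 0) then ENNReal.ofReal (r ^ α * r ^ α) else 0) *
              (ENNReal.ofReal (K.nrm (x 0) ^ (-α)) * f x) := by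
          filter_upwards [ae_radialMeasure_pos α] with r hr
          have hr' : 0 ≤ r ^ α := by positivity
          simp only [hF]
          split_ifs
          · rw [← mul_assoc, ← mul_assoc, ← ENNReal.ofReal_mul hr',
              ← ENNReal.ofReal_mul (mul_nonneg hr' hr'), mul_assoc (r ^ α)]
          · simp
        rw [lintegral_congr_ae hrew, lintegral_mul_const _
          (Measurable.ite measurableSet_Iio (by fun_prop) measurable_const),
          lintegral_radialMeasure_rpow_lt hα hx0, ← mul_assoc,
          ← ENNReal.ofReal_mul (by positivity), ← Real.rpow_add hx0, add_neg_cancel,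
          Real.rpow_zero, ENNReal.ofReal_one, one_mul]

lemma isTailMeasure_of_restrict {α : ℝ} (hα : 0 < α) {μ : Measure (ℤ → E)} [IsProbabilityMeasure μ]
    (hμ : ∀ᵐ x ∂μ, K.nrm (x 0) = 1) {ν : Measure (ℤ → E)} (h0 : ν {K.zeroSeq} = 0)
    (hν : ∀ j, ν.restrict (K.nonvanishing j) = K.polarMeasure α μ j) :
    K.IsTailMeasure α ν := by
  have hone : ∀ j, ν {x | 1 < K.nrm (x j)} = 1 := by
    intro j
    have := K.polarMeasure_one_lt_inter_spectralMap hα hμ j MeasurableSet.univ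
    rwa [Set.preimage_univ, Set.preimage_univ, Set.univ_inter, measure_univ, ← hν j,
      Measure.restrict_apply (K.measurableSet_one_lt_nrm j),
      Set.inter_eq_left.2 (K.one_lt_nrm_subset j)] at this
  refine ⟨h0, hone 0, fun h => by rw [hone h]; exact ENNReal.one_lt_top, fun u hu A hA => ?_⟩
  have hu' : 0 < u⁻¹ := inv_pos.2 hu
  have hmap : ν.map (K.sSmul u⁻¹) = ENNReal.ofReal (u⁻¹ ^ α) • ν := by
    refine K.ext_of_restrict_nonvanishing ?_ (by simp [h0]) fun j => ?_
    · rw [Measure.map_apply (by fun_prop) K.measurableSet_zeroSeq,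
        ← K.image_sSmul hu, Set.image_singleton, K.sSmul_zeroSeq hu, h0]
    · rw [Measure.restrict_map (by fun_prop) (K.measurableSet_nonvanishing j),
        K.preimage_sSmul_nonvanishing hu', Measure.restrict_smul, hν j,
        K.map_sSmul_polarMeasure α μ j hu']
  rw [K.image_sSmul hu, ← Measure.map_apply (by fun_prop) hA, hmap, Measure.smul_apply,
    smul_eq_mul, Real.inv_rpow hu.le, Real.rpow_neg hu.le]

lemma shiftInvariant_of_restrict {α : ℝ} {μ : Measure (ℤ → E)} {ν : Measure (ℤ → E)}
    (h0 : ν {K.zeroSeq} = 0)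
    (hν : ∀ j, ν.restrict (K.nonvanishing j) = K.polarMeasure α μ j) : ShiftInvariant ν := by
  rw [shiftInvariant_iff_map]
  refine K.ext_of_restrict_nonvanishing ?_ h0 fun j => ?_
  · rw [Measure.map_apply (by fun_prop) K.measurableSet_zeroSeq, ← image_seqShift,
      Set.image_singleton]
    exact h0
  · rw [Measure.restrict_map (by fun_prop) (K.measurableSet_nonvanishing j),
      K.preimage_seqShift_nonvanishing, hν, hν, K.map_seqShift_polarMeasure]
    congr 1
    ring

lemma spectralLaw_zero_of_restrict {α : ℝ} (hα : 0 < α) {μ : Measure (ℤ → E)} [SFinite μ]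
    (hμ : ∀ᵐ x ∂μ, K.nrm (x 0) = 1) {ν : Measure (ℤ → E)} (hone : ν {x | 1 < K.nrm (x 0)} = 1)
    (hν : ν.restrict (K.nonvanishing 0) = K.polarMeasure α μ 0) :
    K.spectralLaw ν 0 = μ := by
  refine Measure.ext fun A hA => ?_
  have hm := K.measurable_spectralMap 0
  have := K.polarMeasure_one_lt_inter_spectralMap hα hμ 0 hA
  rw [← hν, Measure.restrict_apply ((hm hA).inter (K.measurableSet_one_lt_nrm 0)),
    Set.inter_eq_left.2 (Set.inter_subset_right.trans (K.one_lt_nrm_subset 0)),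
    show (seqShift 0 : (ℤ → E) → ℤ → E) = id from funext seqShift_zero, Set.preimage_id] at this
  rw [spectralLaw, hone, inv_one, MulAction.one_smul, Measure.map_apply hm hA,
    Measure.restrict_apply (hm hA), this]

lemma restrict_nonvanishing_of_spectralLaw {α : ℝ} (hα : 0 < α) {ν : Measure (ℤ → E)}
    (h : K.IsTailMeasure α ν) (hinv : ShiftInvariant ν) (j : ℤ) :
    ν.restrict (K.nonvanishing j) = K.polarMeasure α (K.spectralLaw ν 0) j := by
  have h0 := congrArg (Measure.map (seqShift j)) (h.restrict_nonvanishing_zero hα)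
  rwa [← sub_self j, ← K.preimage_seqShift_nonvanishing,
    ← Measure.restrict_map (by fun_prop) (K.measurableSet_nonvanishing j), hinv.map_seqShift,
    K.map_seqShift_polarMeasure, sub_self, add_zero] at h0

end MeasCone

open MeasCone in
/-- given (the law of) a process `Θ` with `‖Θ_0‖ = 1` a.s. satisfying the time
change formula, there is a unique shift-invariant tail measure with index `α` whose spectral
tail process has the law of `Θ`; hence the spectral tail process realizes a one-to-one
correspondence. -/
theorem existsUnique_shiftInvariant_tailMeasure_of_TCF
    {E : Type*} [MeasurableSpace E] (K : MeasCone E) (α : ℝ) (hα : 0 < α)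
    (μΘ : Measure (ℤ → E)) [IsProbabilityMeasure μΘ]
    (hunit : μΘ {x | K.nrm (x 0) = 1} = 1)
    (hTCF : K.SatisfiesTCF α μΘ) :
    ∃! ν : Measure (ℤ → E),
      K.IsTailMeasure α ν ∧ ShiftInvariant ν ∧ K.spectralLaw ν 0 = μΘ := by
  have hμ : ∀ᵐ x ∂μΘ, K.nrm (x 0) = 1 :=
    (prob_compl_eq_zero_iff ((K.measurable_nrm_apply 0) (measurableSet_singleton 1))).2 hunit
  obtain ⟨ν, hν0, hν⟩ := exists_measure_restrict_eq K.nonvanishing K.measurableSet_nonvanishing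
    (K.polarMeasure α μΘ) (K.restrict_polarMeasure_nonvanishing hμ)
    (K.polarMeasure_restrict_comm hμ hTCF)
  rw [K.iUnion_nonvanishing, compl_compl] at hν0
  have htail := K.isTailMeasure_of_restrict hα hμ hν0 hν
  refine ⟨ν, ⟨htail, K.shiftInvariant_of_restrict hν0 hν,
    K.spectralLaw_zero_of_restrict hα hμ htail.2.1 (hν 0)⟩, ?_⟩
  rintro ν' ⟨htail', hinv', rfl⟩
  exact K.ext_of_restrict_nonvanishing htail'.1 hν0 fun j => by
    rw [hν j, K.restrict_nonvanishing_of_spectralLaw hα htail' hinv' j]
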